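/- arXiv:1509.05439 — 2 statements merged into one kernel-verified Lean document; each statement's English description precedes it below -/
import Mathlib

section
/- For every integer d ≥ 1: N_{d,d} = d and c(d,d) = 1 + 1/d; if d ≥ 2, N_{d−1,d} = d + 1 and c(d−1,d) = 1; N_{1,d} = d(d+1)/2 and c(1,d) = 2/d. Moreover, for fixed d, the function k ↦ c(k,d) is strictly increasing for 1 ≤ k ≤ d; consequently c(k,d) ≤ 1 whenever 1 ≤ k < d. -/
open Set Filter Metric MeasureTheory
noncomputable section

/-- A point of `ℝ^d` is *rational* if all of its coordinates are rational numbers. -/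
def IsRatPt {d : ℕ} (x : Fin d → ℝ) : Prop := ∀ i, ∃ a : ℚ, x i = (a : ℝ)

/-- The *height* of a rational point `x ∈ ℚ^d ⊆ ℝ^d`: the least positive integer `q`
with `q • x ∈ ℤ^d`. -/
def ht {d : ℕ} (x : Fin d → ℝ) : ℕ :=
  sInf {q : ℕ | 0 < q ∧ ∀ i, ∃ m : ℤ, (q : ℝ) * x i = (m : ℝ)}

/-- `Ssum k n = [k-1,1] + [k-1,2] + ⋯ + [k-1,n]` where `[n,m] = C(n+m,m)`. -/
def Ssum (k n : ℕ) : ℕ := ∑ j ∈ Finset.Icc 1 n, Nat.choose (k - 1 + j) j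

/-- `nkd k d` is the largest `n ≥ 0` with `[k-1,1] + ⋯ + [k-1,n] ≤ d`. -/
def nkd (k d : ℕ) : ℕ := sSup {n : ℕ | Ssum k n ≤ d}

/-- `mkd k d = d − ([k-1,1] + ⋯ + [k-1,n_{k,d}])`. -/
def mkd (k d : ℕ) : ℕ := d - Ssum k (nkd k d)

/-- `Nkd k d = 1·[k-1,1] + 2·[k-1,2] + ⋯ + n_{k,d}·[k-1,n_{k,d}] + (n_{k,d}+1)·m_{k,d}`. -/
def Nkd (k d : ℕ) : ℕ :=
  (∑ j ∈ Finset.Icc 1 (nkd k d), j * Nat.choose (k - 1 + j) j) + (nkd k d + 1) * mkd k d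

/-- The exponent `c(k,d) = (d+1)/N_{k,d}`. -/
def ckd (k d : ℕ) : ℝ := (d + 1) / (Nkd k d)

/-- Directional derivative operator: `dirD v f x = Df(x)(v)`. -/
def dirD {E F : Type*} [NormedAddCommGroup E] [NormedSpace ℝ E]
    [NormedAddCommGroup F] [NormedSpace ℝ F] (v : E) (f : E → F) : E → F :=
  fun x => fderiv ℝ f x v

/-- Iterated partial derivative `∂^α` with respect to the directions `e i`,
where direction `e i` is applied `α i` times. -/
def multiD {ι : Type*} [Fintype ι] {E F : Type*} [NormedAddCommGroup E] [NormedSpace ℝ E]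
    [NormedAddCommGroup F] [NormedSpace ℝ F] (e : ι → E) (α : ι → ℕ) (f : E → F) : E → F :=
  (Finset.univ : Finset ι).toList.foldr (fun i g => (dirD (e i))^[α i] g) f

/-- The partial derivative `∂^α f` for a multi-index `α ∈ ℕ^k`. -/
def mderiv {k : ℕ} {F : Type*} [NormedAddCommGroup F] [NormedSpace ℝ F]
    (α : Fin k → ℕ) (f : (Fin k → ℝ) → F) : (Fin k → ℝ) → F :=
  multiD (fun i => Pi.single i (1 : ℝ)) α f

/-- `Φ : U → M` is a `C^∞` local parameterization of the `k`-dimensional submanifold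
`M ⊆ ℝ^d`: `U` is open, `Φ` is smooth and injective on `U` with everywhere injective
differential, and `Φ` is a homeomorphism of `U` onto a relatively open subset of `M`. -/
structure IsLocParam (k d : ℕ) (M : Set (Fin d → ℝ)) (U : Set (Fin k → ℝ))
    (Φ : (Fin k → ℝ) → (Fin d → ℝ)) : Prop where
  open_dom : IsOpen U
  smooth : ContDiffOn ℝ (⊤ : ℕ∞) Φ U
  inj : Set.InjOn Φ U
  maps_to : Φ '' U ⊆ M
  immersion : ∀ v ∈ U, Function.Injective (fderiv ℝ Φ v)
  open_map : ∀ s : Set (Fin k → ℝ), IsOpen s →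
    ∃ O : Set (Fin d → ℝ), IsOpen O ∧ Φ '' (s ∩ U) = O ∩ M

/-- `M ⊆ ℝ^d` is a `C^∞` submanifold of dimension `k`. -/
def IsSmoothSubmanifold (k d : ℕ) (M : Set (Fin d → ℝ)) : Prop :=
  ∀ x ∈ M, ∃ (U : Set (Fin k → ℝ)) (Φ : (Fin k → ℝ) → (Fin d → ℝ)),
    IsLocParam k d M U Φ ∧ x ∈ Φ '' U

/-- `x ∈ M` is `D`-nondegenerate: for some local parameterization `Φ` with `Φ v = x`,
the partial derivatives `∂^α Φ(v)`, `0 < |α| ≤ D`, span `ℝ^d`. -/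
def IsNondegAt (k d D : ℕ) (M : Set (Fin d → ℝ)) (x : Fin d → ℝ) : Prop :=
  ∃ (U : Set (Fin k → ℝ)) (Φ : (Fin k → ℝ) → (Fin d → ℝ)) (v : Fin k → ℝ),
    IsLocParam k d M U Φ ∧ v ∈ U ∧ Φ v = x ∧
    Submodule.span ℝ {y : Fin d → ℝ | ∃ α : Fin k → ℕ,
      0 < (∑ j, α j) ∧ (∑ j, α j) ≤ D ∧ y = mderiv α Φ v} = ⊤

/-- `x ∈ M` is nondegenerate if it is `D`-nondegenerate for some `D`. -/
def IsNondeg (k d : ℕ) (M : Set (Fin d → ℝ)) (x : Fin d → ℝ) : Prop :=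
  ∃ D : ℕ, IsNondegAt k d D M x

/-- The set `BA_M(ψ_c)` of `ψ_c`-badly intrinsically approximable points of `M`. -/
def BAset {d : ℕ} (M : Set (Fin d → ℝ)) (c : ℝ) : Set (Fin d → ℝ) :=
  {x ∈ M | ∃ κ > (0 : ℝ), ∀ r : Fin d → ℝ, IsRatPt r → r ∈ M →
    κ * (ht r : ℝ) ^ (-c) ≤ ‖x - r‖}

/-- The set `VWA_M(ψ_c)` of `ψ_c`-very well intrinsically approximable points of `M`. -/
def VWAset {d : ℕ} (M : Set (Fin d → ℝ)) (c : ℝ) : Set (Fin d → ℝ) :=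
  {x ∈ M | ∃ ε > (0 : ℝ),
    {r : Fin d → ℝ | IsRatPt r ∧ r ∈ M ∧ ‖x - r‖ ≤ (ht r : ℝ) ^ (-(c + ε))}.Infinite}

/-- `ψ` is a Dirichlet function for intrinsic approximation on `S ⊆ ℝ^m`. -/
def IsDirichletFn {m : ℕ} (S : Set (Fin m → ℝ)) (ψ : ℝ → ℝ) : Prop :=
  (∀ t : ℝ, 0 < t → 0 < ψ t) ∧
  ∀ x ∈ S, ∃ C > (0 : ℝ), ∃ r : ℕ → (Fin m → ℝ),
    (∀ n, IsRatPt (r n) ∧ r n ∈ S) ∧ Filter.Tendsto r Filter.atTop (nhds x) ∧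
    ∀ n, ‖x - r n‖ ≤ C * ψ (ht (r n))

/-- The closed `t`-neighborhood `S^{(t)}` of a set `S`. -/
def cnbhd {E : Type*} [PseudoMetricSpace E] (S : Set E) (t : ℝ) : Set E :=
  {x | ∃ y ∈ S, dist x y ≤ t}

/-- `x` belongs to the (topological) support of the measure `μ`. -/
def InSupp {k : ℕ} (μ : Measure (Fin k → ℝ)) (x : Fin k → ℝ) : Prop :=
  ∀ ρ > (0 : ℝ), 0 < μ (ball x ρ)

/-- `μ` is absolutely decaying on `U`. -/
def AbsolutelyDecaying {k : ℕ} (μ : Measure (Fin k → ℝ)) (U : Set (Fin k → ℝ)) : Prop :=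
  ∃ C > (0 : ℝ), ∃ a > (0 : ℝ), ∀ x, InSupp μ x → ∀ ρ : ℝ, 0 < ρ → ρ ≤ 1 →
    closedBall x ρ ⊆ U → ∀ ε > (0 : ℝ), ∀ (w : Fin k → ℝ) (b : ℝ), w ≠ 0 →
      μ (cnbhd {y : Fin k → ℝ | ∑ j, w j * y j = b} (ε * ρ) ∩ closedBall x ρ) ≤
        ENNReal.ofReal (C * ε ^ a) * μ (closedBall x ρ)

/-- `μ` is doubling. -/
def IsDoubling {k : ℕ} (μ : Measure (Fin k → ℝ)) : Prop :=
  ∃ C > (0 : ℝ), ∀ x, InSupp μ x → ∀ ρ : ℝ, 0 < ρ → ρ ≤ 1 →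
    μ (closedBall x (2 * ρ)) ≤ ENNReal.ofReal C * μ (closedBall x ρ)

/-- `μ` is absolutely friendly on `U`: absolutely decaying and doubling. -/
def AbsolutelyFriendly {k : ℕ} (μ : Measure (Fin k → ℝ)) (U : Set (Fin k → ℝ)) : Prop :=
  AbsolutelyDecaying μ U ∧ IsDoubling μ

/-- The class `P_D` of polynomials of degree at most `D` whose coefficient of largest
absolute value has absolute value exactly `1`. -/
def IsPD (k D : ℕ) (p : MvPolynomial (Fin k) ℝ) : Prop :=
  p.totalDegree ≤ D ∧ (∀ m, |p.coeff m| ≤ 1) ∧ ∃ m, |p.coeff m| = 1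

/-- Partial derivative within a set `s`, in the `i`-th coordinate direction. -/
def pderivW {k : ℕ} (s : Set (Fin k → ℝ)) (i : Fin k) (f : (Fin k → ℝ) → ℝ) :
    (Fin k → ℝ) → ℝ :=
  fun x => fderivWithin ℝ f s x (Pi.single i 1)

/-- Iterated partial derivative `∂^α f` within a set `s`. -/
def mderivW {k : ℕ} (s : Set (Fin k → ℝ)) (α : Fin k → ℕ) (f : (Fin k → ℝ) → ℝ) :
    (Fin k → ℝ) → ℝ :=
  (List.finRange k).foldr (fun i g => (pderivW s i)^[α i] g) f

/-- The `C^D` norm `‖f‖_{C^D,B}` of `f` on `B`. -/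
def CDnorm {k : ℕ} (D : ℕ) (B : Set (Fin k → ℝ)) (f : (Fin k → ℝ) → ℝ) : ℝ :=
  sSup {y : ℝ | ∃ α : Fin k → ℕ, (∑ j, α j) ≤ D ∧ ∃ x ∈ B, y = |mderivW B α f x|}

/-- Analytic local parameterization. -/
structure IsAnalLocParam (k d : ℕ) (M : Set (Fin d → ℝ)) (U : Set (Fin k → ℝ))
    (Φ : (Fin k → ℝ) → (Fin d → ℝ)) : Prop where
  open_dom : IsOpen U
  analytic : AnalyticOnNhd ℝ Φ U
  inj : Set.InjOn Φ U
  maps_to : Φ '' U ⊆ M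
  immersion : ∀ v ∈ U, Function.Injective (fderiv ℝ Φ v)
  open_map : ∀ s : Set (Fin k → ℝ), IsOpen s →
    ∃ O : Set (Fin d → ℝ), IsOpen O ∧ Φ '' (s ∩ U) = O ∩ M

/-- `M ⊆ ℝ^d` is a real-analytic submanifold of dimension `k`. -/
def IsAnalSubmanifold (k d : ℕ) (M : Set (Fin d → ℝ)) : Prop :=
  ∀ x ∈ M, ∃ (U : Set (Fin k → ℝ)) (Φ : (Fin k → ℝ) → (Fin d → ℝ)),
    IsAnalLocParam k d M U Φ ∧ x ∈ Φ '' U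

/-- `D`-nondegeneracy via an analytic local parameterization. -/
def IsAnalNondegAt (k d D : ℕ) (M : Set (Fin d → ℝ)) (x : Fin d → ℝ) : Prop :=
  ∃ (U : Set (Fin k → ℝ)) (Φ : (Fin k → ℝ) → (Fin d → ℝ)) (v : Fin k → ℝ),
    IsAnalLocParam k d M U Φ ∧ v ∈ U ∧ Φ v = x ∧
    Submodule.span ℝ {y : Fin d → ℝ | ∃ α : Fin k → ℕ,
      0 < (∑ j, α j) ∧ (∑ j, α j) ≤ D ∧ y = mderiv α Φ v} = ⊤

/-- Nondegeneracy via an analytic local parameterization. -/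
def IsAnalNondeg (k d : ℕ) (M : Set (Fin d → ℝ)) (x : Fin d → ℝ) : Prop :=
  ∃ D : ℕ, IsAnalNondegAt k d D M x

theorem Ssum_zero (k : ℕ) : Ssum k 0 = 0 := by simp [Ssum]

theorem Ssum_succ (k n : ℕ) :
    Ssum k (n + 1) = Ssum k n + Nat.choose (k - 1 + (n + 1)) (n + 1) := by
  simp [Ssum, Finset.sum_Icc_succ_top]

theorem Ssum_one {k : ℕ} (hk : 1 ≤ k) : Ssum k 1 = k := by
  simp [Ssum]; omega

theorem Ssum_strictMono (k : ℕ) : StrictMono (Ssum k) :=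
  strictMono_nat_of_lt_succ fun n => by
    have : 0 < Nat.choose (k - 1 + (n + 1)) (n + 1) := Nat.choose_pos (by omega)
    rw [Ssum_succ]
    omega

theorem Ssum_mono_left {k l : ℕ} (h : k ≤ l) (n : ℕ) : Ssum k n ≤ Ssum l n :=
  Finset.sum_le_sum fun _ _ => Nat.choose_le_choose _ (by omega)

theorem Ssum_one_left (n : ℕ) : Ssum 1 n = n := by
  simp [Ssum]

theorem bddAbove_Ssum_le (k d : ℕ) : BddAbove {n : ℕ | Ssum k n ≤ d} :=
  ⟨d, fun n hn => ((Ssum_strictMono k).le_apply (x := n)).trans hn⟩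

theorem Ssum_nkd_le (k d : ℕ) : Ssum k (nkd k d) ≤ d :=
  Nat.sSup_mem (s := {n : ℕ | Ssum k n ≤ d}) ⟨0, by simp [Ssum_zero]⟩ (bddAbove_Ssum_le k d)

theorem lt_Ssum_of_nkd_lt {k d n : ℕ} (h : nkd k d < n) : d < Ssum k n := by
  by_contra! hn
  exact h.not_ge (le_csSup (bddAbove_Ssum_le k d) hn)

theorem sum_range_sub_Ssum {k d n : ℕ} (h : Ssum k n ≤ d) :
    ∑ i ∈ Finset.range (n + 1), (d - Ssum k i) =
      (∑ j ∈ Finset.Icc 1 n, j * Nat.choose (k - 1 + j) j) + (n + 1) * (d - Ssum k n) := by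
  induction n with
  | zero => simp
  | succ n ih =>
    rw [Finset.sum_range_succ, ih (((Ssum_strictMono k).monotone n.le_succ).trans h),
      Finset.sum_Icc_succ_top (by omega)]
    rw [Ssum_succ] at h ⊢
    obtain ⟨c, rfl⟩ := Nat.exists_eq_add_of_le h
    rw [Nat.add_sub_cancel_left, Nat.add_assoc (Ssum k n), Nat.add_sub_cancel_left]
    ring

/-- `Nkd k d` is the sum over all `n` of the positive parts of `d - Ssum k n`. -/
theorem Nkd_eq_sum (k d : ℕ) : Nkd k d = ∑ n ∈ Finset.range (d + 1), (d - Ssum k n) := by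
  rw [Nkd, mkd, ← sum_range_sub_Ssum (Ssum_nkd_le k d)]
  refine Finset.sum_subset (fun n hn => ?_) fun n _ hn => ?_
  · have := ((Ssum_strictMono k).le_apply (x := nkd k d)).trans (Ssum_nkd_le k d)
    simp only [Finset.mem_range] at hn ⊢
    omega
  · exact Nat.sub_eq_zero_of_le (lt_Ssum_of_nkd_lt (by simpa using hn)).le

theorem le_Nkd (k d : ℕ) : d ≤ Nkd k d := by
  rw [Nkd_eq_sum, Finset.sum_range_succ', Ssum_zero]
  omega

theorem Nkd_self {d : ℕ} (hd : 1 ≤ d) : Nkd d d = d := by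
  rw [Nkd_eq_sum, Finset.sum_range_succ', Ssum_zero, Finset.sum_eq_zero, Nat.zero_add, Nat.sub_zero]
  intro n _
  have := (Ssum_strictMono d).monotone (Nat.le_add_left 1 n)
  rw [Ssum_one hd] at this
  omega

theorem Nkd_pred_self {d : ℕ} (hd : 2 ≤ d) : Nkd (d - 1) d = d + 1 := by
  obtain ⟨d, rfl⟩ := Nat.exists_eq_add_of_le' hd
  have h1 : Ssum (d + 1) 1 = d + 1 := Ssum_one (by omega)
  rw [Nkd_eq_sum, Finset.sum_range_succ', Finset.sum_range_succ', Finset.sum_eq_zero]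
  · simp only [Nat.add_one_sub_one, Nat.zero_add, h1, Ssum_zero]
    omega
  · intro n _
    have := Ssum_strictMono (d + 1) (show 1 < n + 1 + 1 by omega)
    simp only [Nat.add_one_sub_one]
    omega

theorem two_mul_Nkd_one (d : ℕ) : 2 * Nkd 1 d = d * (d + 1) := by
  rw [Nkd_eq_sum]
  simp only [Ssum_one_left]
  have := Finset.sum_range_reflect (fun i => i) (d + 1)
  simp only [Nat.add_sub_cancel] at this
  rw [this, mul_comm, Finset.sum_range_id_mul_two, Nat.add_sub_cancel, mul_comm]

theorem Nkd_lt_Nkd {k l d : ℕ} (hk : 1 ≤ k) (hkl : k < l) (hl : l ≤ d) :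
    Nkd l d < Nkd k d := by
  rw [Nkd_eq_sum, Nkd_eq_sum]
  refine Finset.sum_lt_sum (fun n _ => Nat.sub_le_sub_left (Ssum_mono_left hkl.le n) d)
    ⟨1, by simp; omega, ?_⟩
  rw [Ssum_one hk, Ssum_one (by omega)]
  omega

theorem ckd_lt_ckd {k l d : ℕ} (hk : 1 ≤ k) (hkl : k < l) (hl : l ≤ d) :
    ckd k d < ckd l d := by
  have hpos : (0 : ℝ) < Nkd l d := by exact_mod_cast (show 0 < d by omega).trans_le (le_Nkd l d)
  exact div_lt_div_of_pos_left (by positivity) hpos (by exact_mod_cast Nkd_lt_Nkd hk hkl hl)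

theorem ckd_pred_self {d : ℕ} (hd : 2 ≤ d) : ckd (d - 1) d = 1 := by
  rw [ckd, Nkd_pred_self hd]
  push_cast
  exact div_self (by positivity)

/-- **Special values and monotonicity of `c(k,d)`:** `N_{d,d} = d`,
`c(d,d) = 1 + 1/d`; for `d ≥ 2`, `N_{d−1,d} = d+1` and `c(d−1,d) = 1`;
`N_{1,d} = d(d+1)/2` and `c(1,d) = 2/d`; `k ↦ c(k,d)` is strictly increasing on
`1 ≤ k ≤ d`; consequently `c(k,d) ≤ 1` for `1 ≤ k < d`. -/
theorem ckd_special_values (d : ℕ) (hd : 1 ≤ d) :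
    Nkd d d = d ∧ ckd d d = 1 + 1 / (d : ℝ) ∧
    (2 ≤ d → Nkd (d - 1) d = d + 1 ∧ ckd (d - 1) d = 1) ∧
    2 * Nkd 1 d = d * (d + 1) ∧ ckd 1 d = 2 / (d : ℝ) ∧
    (∀ k₁ k₂ : ℕ, 1 ≤ k₁ → k₁ < k₂ → k₂ ≤ d → ckd k₁ d < ckd k₂ d) ∧
    (∀ k : ℕ, 1 ≤ k → k < d → ckd k d ≤ 1) := by
  have hd0 : (d : ℝ) ≠ 0 := by exact_mod_cast (show d ≠ 0 by omega)
  refine ⟨Nkd_self hd, ?_, fun h => ⟨Nkd_pred_self h, ckd_pred_self h⟩, two_mul_Nkd_one d, ?_,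
    fun _ _ => ckd_lt_ckd, fun k hk hkd => ?_⟩
  · rw [ckd, Nkd_self hd]
    field_simp
  · have h : (2 : ℝ) * Nkd 1 d = d * (d + 1) := by exact_mod_cast two_mul_Nkd_one d
    have hN : (Nkd 1 d : ℝ) ≠ 0 := by
      exact_mod_cast ((show 0 < d by omega).trans_le (le_Nkd 1 d)).ne'
    rw [ckd, div_eq_div_iff hN hd0]
    linarith
  · rw [← ckd_pred_self (show 2 ≤ d by omega)]
    rcases (show k ≤ d - 1 by omega).eq_or_lt with rfl | hlt
    · exact le_rfl
    · exact (ckd_lt_ckd hk hlt (by omega)).le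
end
end

section
/- Fix integers k, D ≥ 1 and β > 0, and let B = B(0,1) be the closed unit ball in ℝ^k. Then there exists δ > 0 such that for every C^{D+1} function f: B → ℝ which is not identically zero and satisfies sup_B |∂^α f| ≤ δ·‖f‖_{C^D,B} for every multi-index α ∈ ℕ^k with |α| = D + 1, there exists a polynomial g ∈ P_D such that Z_f ⊆ f^{−1}((−δ‖f‖_{C^D,B}, δ‖f‖_{C^D,B})) ⊆ Z_g^{(β)}; in particular Z_f^{(β)} ⊆ Z_g^{(2β)}. -/
open Set Filter Metric MeasureTheory
noncomputable section

/-- The iterated partial derivative within `s` along a word of coordinate directions. -/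
def wordDerivW {k : ℕ} (s : Set (Fin k → ℝ)) (w : List (Fin k)) (f : (Fin k → ℝ) → ℝ) :
    (Fin k → ℝ) → ℝ :=
  w.foldr (pderivW s) f

/-- The exponent vector counting the letters of a word. -/
def wordExponent {k : ℕ} (w : List (Fin k)) : Fin k →₀ ℕ :=
  (w.map fun i => Finsupp.single i 1).sum

/-- The iterated formal partial derivative of a polynomial along a word. -/
def wordPDeriv {k : ℕ} (w : List (Fin k)) (p : MvPolynomial (Fin k) ℝ) :
    MvPolynomial (Fin k) ℝ :=
  w.foldr (fun i q => MvPolynomial.pderiv i q) p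

section WordDerivatives

variable {k : ℕ} {s : Set (Fin k → ℝ)} {f g : (Fin k → ℝ) → ℝ}

lemma wordExponent_apply (w : List (Fin k)) (j : Fin k) : wordExponent w j = w.count j := by
  induction w with
  | nil => simp [wordExponent]
  | cons i w ih =>
    have : wordExponent (i :: w) = Finsupp.single i 1 + wordExponent w := by simp [wordExponent]
    rw [this, Finsupp.add_apply, ih, List.count_cons, Finsupp.single_apply, add_comm]
    simp

lemma sum_wordExponent (w : List (Fin k)) : ∑ j, wordExponent w j = w.length := by
  simp only [wordExponent_apply]
  have h := Multiset.sum_count_eq_card (s := Finset.univ) (m := (w : Multiset (Fin k)))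
    (fun a _ => Finset.mem_univ a)
  simpa using h

lemma pderivW_congr (h : EqOn f g s) (i : Fin k) : EqOn (pderivW s i f) (pderivW s i g) s := by
  intro x hx
  simp only [pderivW, fderivWithin_congr h (h hx)]

lemma contDiffOn_pderivW {m n : ℕ} (hs : UniqueDiffOn ℝ s) (hf : ContDiffOn ℝ n f s)
    (hmn : m + 1 ≤ n) (i : Fin k) : ContDiffOn ℝ m (pderivW s i f) s :=
  (hf.fderivWithin hs (by exact_mod_cast hmn)).clm_apply contDiffOn_const

lemma contDiffOn_wordDerivW {n : ℕ} (hs : UniqueDiffOn ℝ s) (hf : ContDiffOn ℝ n f s)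
    (w : List (Fin k)) {m : ℕ} (hm : m + w.length ≤ n) :
    ContDiffOn ℝ m (wordDerivW s w f) s := by
  induction w generalizing m with
  | nil => exact hf.of_le (by exact_mod_cast hm)
  | cons i w ih =>
    exact contDiffOn_pderivW hs (ih (m := m + 1) (by simp at hm; omega)) le_rfl i

lemma pderivW_comm (hs : UniqueDiffOn ℝ s) (hs' : s ⊆ closure (interior s))
    (hf : ContDiffOn ℝ 2 f s) (i j : Fin k) :
    EqOn (pderivW s i (pderivW s j f)) (pderivW s j (pderivW s i f)) s := by
  intro x hx
  have key : ∀ a b : Fin k, pderivW s a (pderivW s b f) x =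
      fderivWithin ℝ (fderivWithin ℝ f s) s x (Pi.single a 1) (Pi.single b 1) := by
    intro a b
    have hd : DifferentiableWithinAt ℝ (fderivWithin ℝ f s) s x :=
      (hf.fderivWithin hs (m := 1) (by norm_num)).differentiableOn (by norm_num) x hx
    change fderivWithin ℝ (fun y => fderivWithin ℝ f s y (Pi.single b 1)) s x (Pi.single a 1) = _
    rw [fderivWithin_clm_apply (hs x hx) hd (differentiableWithinAt_const _)]
    simp
  rw [key, key]
  exact (hf x hx).isSymmSndFDerivWithinAt (by simp) hs (hs' hx) hx _ _

lemma wordDerivW_perm {n : ℕ} (hs : UniqueDiffOn ℝ s) (hs' : s ⊆ closure (interior s))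
    (hf : ContDiffOn ℝ n f s) {w v : List (Fin k)} (h : w.Perm v) (hw : w.length ≤ n) :
    EqOn (wordDerivW s w f) (wordDerivW s v f) s := by
  induction h with
  | nil => exact fun _ _ => rfl
  | cons i _ ih => exact pderivW_congr (ih (by simp at hw; omega)) i
  | swap i j l =>
    exact pderivW_comm hs hs' (contDiffOn_wordDerivW (m := 2) hs hf l (by simp at hw; omega)) _ _
  | trans h₁ _ ih₁ ih₂ => exact (ih₁ hw).trans (ih₂ (h₁.length_eq ▸ hw))

lemma mderivW_eq_wordDerivW (α : Fin k → ℕ) :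
    mderivW s α f =
      wordDerivW s ((List.finRange k).flatMap fun i => List.replicate (α i) i) f := by
  simp only [mderivW, wordDerivW]
  induction List.finRange k with
  | nil => rfl
  | cons i l ih =>
    rw [List.foldr_cons, ih, List.flatMap_cons, List.foldr_append]
    generalize List.foldr (pderivW s) f _ = g
    induction α i with
    | zero => rfl
    | succ n ihn => rw [Function.iterate_succ_apply', ihn, List.replicate_succ, List.foldr_cons]

lemma mderivW_zero : mderivW s 0 f = f := by
  rw [mderivW_eq_wordDerivW, List.flatMap_eq_nil_iff.2 (by simp)]
  rfl

lemma count_flatMap_replicate_finRange (α : Fin k → ℕ) (j : Fin k) :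
    ((List.finRange k).flatMap fun i => List.replicate (α i) i).count j = α j := by
  rw [List.count_flatMap, ← List.ofFn_eq_map, List.sum_ofFn]
  simp [List.count_replicate]

lemma wordDerivW_eq_mderivW {n : ℕ} (hs : UniqueDiffOn ℝ s) (hs' : s ⊆ closure (interior s))
    (hf : ContDiffOn ℝ n f s) {w : List (Fin k)} (hw : w.length ≤ n) :
    EqOn (wordDerivW s w f) (mderivW s (wordExponent w) f) s := by
  rw [mderivW_eq_wordDerivW]
  refine wordDerivW_perm hs hs' hf (List.perm_iff_count.2 fun j => ?_) hw
  rw [count_flatMap_replicate_finRange, wordExponent_apply]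

lemma exists_wordExponent_eq (α : Fin k → ℕ) : ∃ w : List (Fin k), ⇑(wordExponent w) = α :=
  ⟨(List.finRange k).flatMap fun i => List.replicate (α i) i, funext fun j => by
    rw [wordExponent_apply, count_flatMap_replicate_finRange]⟩

lemma wordDerivW_sub {n : ℕ} (hs : UniqueDiffOn ℝ s) (hf : ContDiffOn ℝ n f s)
    (hg : ContDiffOn ℝ n g s) (w : List (Fin k)) (hw : w.length ≤ n) :
    EqOn (wordDerivW s w (f - g)) (wordDerivW s w f - wordDerivW s w g) s := by
  induction w with
  | nil => exact fun _ _ => rfl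
  | cons i w ih =>
    have hw' : 1 + w.length ≤ n := by simp at hw; omega
    intro x hx
    refine (pderivW_congr (ih (by omega)) i hx).trans ?_
    have hf' := (contDiffOn_wordDerivW hs hf w hw').differentiableOn (by norm_num) x hx
    have hg' := (contDiffOn_wordDerivW hs hg w hw').differentiableOn (by norm_num) x hx
    simp only [pderivW]
    rw [fderivWithin_sub (hs x hx) hf' hg']
    rfl

/-- If the partial derivatives of order at most `n` are bounded by `a` at a point of a convex set,
and those of order `n + 1` are bounded by `a` on the set, then all of them are bounded
on the part of the set at distance at most `1` from the point. -/
lemma abs_wordDerivW_le {n : ℕ} {a : ℝ} {y : Fin k → ℝ} (ha : 0 ≤ a) (hs : UniqueDiffOn ℝ s)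
    (hconv : Convex ℝ s) (hy : y ∈ s) (hsy : s ⊆ closedBall y 1)
    (hf : ContDiffOn ℝ (n + 1 : ℕ) f s)
    (h₀ : ∀ w : List (Fin k), w.length ≤ n → |wordDerivW s w f y| ≤ a)
    (h₁ : ∀ w : List (Fin k), w.length = n + 1 → ∀ x ∈ s, |wordDerivW s w f x| ≤ a)
    (w : List (Fin k)) (hw : w.length ≤ n + 1) :
    ∀ x ∈ s, |wordDerivW s w f x| ≤ a * (1 + k) ^ (n + 1) := by
  have key : ∀ r : ℕ, ∀ w : List (Fin k), w.length + r = n + 1 →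
      ∀ x ∈ s, |wordDerivW s w f x| ≤ a * (1 + k) ^ r := by
    intro r
    induction r with
    | zero => simpa using h₁
    | succ r ih =>
      intro w hw x hx
      set b : ℝ := a * (1 + k) ^ r with hb
      have hb0 : 0 ≤ b := by positivity
      have hd : DifferentiableOn ℝ (wordDerivW s w f) s :=
        (contDiffOn_wordDerivW (m := 1) hs hf w (by omega)).differentiableOn (by norm_num)
      have hbound : ∀ z ∈ s, ‖fderivWithin ℝ (wordDerivW s w f) s z‖ ≤ k * b := by
        intro z hz
        refine ContinuousLinearMap.opNorm_le_bound _ (by positivity) fun v => ?_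
        set T := fderivWithin ℝ (wordDerivW s w f) s z with hT
        have hsum : T v = ∑ i, v i * T (Pi.single i 1) := by
          conv_lhs => rw [pi_eq_sum_univ' v]
          simp [map_sum]
        rw [hsum]
        refine (norm_sum_le _ _).trans ?_
        have : ∀ i ∈ Finset.univ, ‖v i * T (Pi.single i 1)‖ ≤ b * ‖v‖ := by
          intro i _
          rw [norm_mul, mul_comm]
          exact mul_le_mul (ih (i :: w) (by simp; omega) z hz) (norm_le_pi_norm v i)
            (norm_nonneg _) hb0
        refine (Finset.sum_le_sum this).trans_eq ?_
        simp [mul_assoc]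
      have hmv := hconv.norm_image_sub_le_of_norm_fderivWithin_le hd hbound hy hx
      have hxy : ‖x - y‖ ≤ 1 := by simpa [dist_eq_norm] using hsy hx
      have h0 := h₀ w (by omega)
      have hab : a ≤ b := le_mul_of_one_le_right ha (one_le_pow₀ (by simp))
      rw [Real.norm_eq_abs] at hmv
      have h3 : k * b * ‖x - y‖ ≤ k * b := mul_le_of_le_one_right (by positivity) hxy
      have h4 := abs_sub_abs_le_abs_sub (wordDerivW s w f x) (wordDerivW s w f y)
      calc |wordDerivW s w f x| ≤ b + k * b := by linarith
        _ = a * (1 + k) ^ (r + 1) := by rw [hb]; ring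
  intro x hx
  refine (key (n + 1 - w.length) w (by omega) x hx).trans ?_
  gcongr
  · simp
  · omega

end WordDerivatives

section Polynomial

variable {k : ℕ}

lemma hasFDerivAt_eval_mvPolynomial (p : MvPolynomial (Fin k) ℝ) (x : Fin k → ℝ) :
    HasFDerivAt (fun y => MvPolynomial.eval y p)
      (∑ i, MvPolynomial.eval x (MvPolynomial.pderiv i p) •
        (ContinuousLinearMap.proj i : (Fin k → ℝ) →L[ℝ] ℝ)) x := by
  induction p using MvPolynomial.induction_on with
  | C a => simpa using hasFDerivAt_const a x
  | add p q hp hq => simpa [add_smul, Finset.sum_add_distrib] using hp.fun_add hq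
  | mul_X p j hp =>
    have h := hp.mul (hasFDerivAt_apply (𝕜 := ℝ) j x)
    simp only [map_mul, MvPolynomial.eval_X]
    refine h.congr_fderiv ?_
    simp only [MvPolynomial.pderiv_mul, map_add, map_mul, MvPolynomial.eval_X, add_smul,
      Finset.sum_add_distrib, MvPolynomial.pderiv_X, Finset.smul_sum, smul_smul]
    rw [add_comm]
    congr 1
    · simp [mul_comm]
    · rw [Finset.sum_eq_single j]
      · simp
      · intro i _ hij
        simp [hij]
      · simp

lemma contDiff_eval_mvPolynomial (p : MvPolynomial (Fin k) ℝ) (n : WithTop ℕ∞) :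
    ContDiff ℝ n fun y => MvPolynomial.eval y p := by
  induction p using MvPolynomial.induction_on with
  | C a => simpa using contDiff_const
  | add p q hp hq => simpa using hp.add hq
  | mul_X p j hp => simpa using hp.mul (contDiff_apply ℝ ℝ j)

lemma wordDerivW_eval {s : Set (Fin k → ℝ)} (hs : UniqueDiffOn ℝ s)
    (p : MvPolynomial (Fin k) ℝ) (w : List (Fin k)) :
    EqOn (wordDerivW s w fun y => MvPolynomial.eval y p)
      (fun y => MvPolynomial.eval y (wordPDeriv w p)) s := by
  induction w with
  | nil => exact fun _ _ => rfl
  | cons i w ih =>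
    intro x hx
    refine (pderivW_congr ih i hx).trans ?_
    rw [pderivW, (hasFDerivAt_eval_mvPolynomial _ x).hasFDerivWithinAt.fderivWithin (hs x hx)]
    simp [wordPDeriv, Pi.single_apply]

lemma prod_factorial_add_single (m : Fin k →₀ ℕ) (i : Fin k) :
    ∏ j, ((m + Finsupp.single i 1 : Fin k →₀ ℕ) j).factorial = (m i + 1) * ∏ j, (m j).factorial := by
  rw [← Finset.mul_prod_erase _ _ (Finset.mem_univ i),
    ← Finset.mul_prod_erase _ (fun j => (m j).factorial) (Finset.mem_univ i), ← mul_assoc]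
  congr 1
  · simp [Nat.factorial_succ]
  · refine Finset.prod_congr rfl fun j hj => ?_
    simp [(Finset.ne_of_mem_erase hj).symm]

lemma prod_factorial_mul_coeff_wordPDeriv (p : MvPolynomial (Fin k) ℝ) (w : List (Fin k))
    (m : Fin k →₀ ℕ) :
    ((∏ j, (m j).factorial : ℕ) : ℝ) * (wordPDeriv w p).coeff m =
      ((∏ j, ((m + wordExponent w : Fin k →₀ ℕ) j).factorial : ℕ) : ℝ) * p.coeff (m + wordExponent w) := by
  induction w generalizing m with
  | nil => simp [wordPDeriv, wordExponent]
  | cons i w ih =>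
    have h₁ : wordPDeriv (i :: w) p = MvPolynomial.pderiv i (wordPDeriv w p) := rfl
    have h₂ : m + wordExponent (i :: w) = m + Finsupp.single i 1 + wordExponent w := by
      simp [wordExponent, add_assoc]
    rw [h₁, h₂, ← ih, MvPolynomial.coeff_pderiv, prod_factorial_add_single]
    push_cast
    ring

lemma eval_zero_wordPDeriv (p : MvPolynomial (Fin k) ℝ) (w : List (Fin k)) :
    MvPolynomial.eval 0 (wordPDeriv w p) =
      ((∏ j, (wordExponent w j).factorial : ℕ) : ℝ) * p.coeff (wordExponent w) := by
  have h := prod_factorial_mul_coeff_wordPDeriv p w 0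
  rw [← MvPolynomial.constantCoeff_eq] at h
  simpa [MvPolynomial.eval_zero'] using h

lemma wordPDeriv_eq_zero {p : MvPolynomial (Fin k) ℝ} {w : List (Fin k)}
    (h : p.totalDegree < w.length) : wordPDeriv w p = 0 := by
  ext m
  have hm := prod_factorial_mul_coeff_wordPDeriv p w m
  rw [MvPolynomial.coeff_eq_zero_of_totalDegree_lt (d := m + wordExponent w), mul_zero] at hm
  · refine (mul_eq_zero.1 hm).resolve_left ?_
    exact_mod_cast Finset.prod_ne_zero_iff.2 fun j _ => Nat.factorial_ne_zero _
  · refine h.trans_le ?_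
    change _ ≤ (m + wordExponent w).degree
    rw [Finsupp.degree_eq_sum]
    simp [Finset.sum_add_distrib, sum_wordExponent]

end Polynomial

/-- The exponent vectors of total degree at most `D`. -/
def lowExponents (k D : ℕ) : Finset (Fin k →₀ ℕ) :=
  (Finset.range (D + 1)).biUnion fun n => Finset.univ.finsuppAntidiag n

/-- The polynomial of degree at most `D` with a prescribed family of coefficients. -/
def polyOfCoeffs {k D : ℕ} (c : lowExponents k D → ℝ) : MvPolynomial (Fin k) ℝ :=
  ∑ m, MvPolynomial.monomial m.1 (c m)

section Coefficients

variable {k D : ℕ}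

lemma mem_lowExponents {m : Fin k →₀ ℕ} : m ∈ lowExponents k D ↔ ∑ j, m j ≤ D := by
  simp [lowExponents, Finset.mem_finsuppAntidiag]

lemma coeff_polyOfCoeffs (c : lowExponents k D → ℝ) (m : lowExponents k D) :
    (polyOfCoeffs c).coeff m = c m := by
  simp [polyOfCoeffs, MvPolynomial.coeff_sum, MvPolynomial.coeff_monomial]

lemma coeff_polyOfCoeffs_of_notMem (c : lowExponents k D → ℝ) {m : Fin k →₀ ℕ}
    (hm : m ∉ lowExponents k D) : (polyOfCoeffs c).coeff m = 0 := by
  rw [polyOfCoeffs, MvPolynomial.coeff_sum]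
  refine Finset.sum_eq_zero fun a _ => ?_
  rw [MvPolynomial.coeff_monomial, if_neg]
  rintro rfl
  exact hm a.2

lemma totalDegree_polyOfCoeffs_le (c : lowExponents k D → ℝ) :
    (polyOfCoeffs c).totalDegree ≤ D := by
  refine Finset.sup_le fun m hm => ?_
  by_contra h
  refine MvPolynomial.mem_support_iff.1 hm (coeff_polyOfCoeffs_of_notMem c fun hm' => h ?_)
  rw [Finsupp.sum_fintype _ _ fun _ => rfl]
  exact mem_lowExponents.1 hm'

lemma isPD_polyOfCoeffs {c : lowExponents k D → ℝ} (hc : ‖c‖ = 1) :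
    IsPD k D (polyOfCoeffs c) := by
  refine ⟨totalDegree_polyOfCoeffs_le c, fun m => ?_, ?_⟩
  · by_cases hm : m ∈ lowExponents k D
    · rw [coeff_polyOfCoeffs c ⟨m, hm⟩]
      exact (norm_le_pi_norm c _).trans_eq hc
    · simp [coeff_polyOfCoeffs_of_notMem c hm]
  · by_contra! h
    refine hc.not_lt ((pi_norm_lt_iff one_pos).2 fun m => ?_)
    refine lt_of_le_of_ne ((norm_le_pi_norm c m).trans_eq hc) ?_
    simpa [coeff_polyOfCoeffs] using h m

lemma eval_polyOfCoeffs (c : lowExponents k D → ℝ) (x : Fin k → ℝ) :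
    MvPolynomial.eval x (polyOfCoeffs c) = ∑ m, c m * ∏ j, x j ^ m.1 j := by
  simp [polyOfCoeffs, map_sum, MvPolynomial.eval_monomial, Finsupp.prod_fintype]

lemma eval_polyOfCoeffs_sub (c c' : lowExponents k D → ℝ) (x : Fin k → ℝ) :
    MvPolynomial.eval x (polyOfCoeffs (c - c')) =
      MvPolynomial.eval x (polyOfCoeffs c) - MvPolynomial.eval x (polyOfCoeffs c') := by
  simp [eval_polyOfCoeffs, sub_mul]

lemma eval_polyOfCoeffs_smul (t : ℝ) (c : lowExponents k D → ℝ) (x : Fin k → ℝ) :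
    MvPolynomial.eval x (polyOfCoeffs (t • c)) = t * MvPolynomial.eval x (polyOfCoeffs c) := by
  simp [eval_polyOfCoeffs, Finset.mul_sum, mul_assoc]

lemma abs_eval_polyOfCoeffs_le (c : lowExponents k D → ℝ) {x : Fin k → ℝ}
    (hx : x ∈ closedBall (0 : Fin k → ℝ) 1) :
    |MvPolynomial.eval x (polyOfCoeffs c)| ≤ (lowExponents k D).card * ‖c‖ := by
  rw [eval_polyOfCoeffs]
  refine (Finset.abs_sum_le_sum_abs _ _).trans ?_
  have h : ∀ m ∈ (Finset.univ : Finset (lowExponents k D)),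
      |c m * ∏ j, x j ^ m.1 j| ≤ ‖c‖ := by
    intro m _
    rw [abs_mul, Finset.abs_prod]
    refine (mul_le_of_le_one_right (abs_nonneg _) ?_).trans (norm_le_pi_norm c m)
    refine Finset.prod_le_one (fun _ _ => abs_nonneg _) fun j _ => ?_
    rw [abs_pow]
    exact pow_le_one₀ (abs_nonneg _) ((norm_le_pi_norm x j).trans (by simpa using hx))
  exact (Finset.sum_le_card_nsmul _ _ _ h).trans_eq (by simp)

/-- Near-zero sets in the unit ball of a continuous function lie close to its zero set. -/
lemma exists_pos_abs_le_imp_mem_cnbhd {F : (Fin k → ℝ) → ℝ} (hF : Continuous F) {β : ℝ}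
    (hβ : 0 < β) :
    ∃ ε > (0 : ℝ), ∀ x ∈ closedBall (0 : Fin k → ℝ) 1, |F x| < ε →
      x ∈ cnbhd {y | F y = 0} β := by
  set K : Set (Fin k → ℝ) := closedBall 0 1 \ thickening β {y | F y = 0} with hK
  have hKc : IsCompact K := (isCompact_closedBall _ _).diff isOpen_thickening
  have hsub : ∀ x ∈ closedBall (0 : Fin k → ℝ) 1, x ∉ K → x ∈ cnbhd {y | F y = 0} β := by
    intro x hx hxK
    have : x ∈ thickening β {y | F y = 0} := by
      by_contra h
      exact hxK ⟨hx, h⟩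
    obtain ⟨y, hy, hxy⟩ := mem_thickening_iff.1 this
    exact ⟨y, hy, hxy.le⟩
  rcases K.eq_empty_or_nonempty with hKe | hKn
  · exact ⟨1, one_pos, fun x hx _ => hsub x hx (by simp [hKe])⟩
  · obtain ⟨z, hz, hmin⟩ := hKc.exists_isMinOn hKn hF.abs.continuousOn
    refine ⟨|F z|, abs_pos.2 fun h => hz.2 ?_, fun x hx hlt => hsub x hx fun hxK => ?_⟩
    · exact self_subset_thickening hβ _ h
    · exact hlt.not_ge (hmin hxK)

/-- Uniformly over coefficient families of norm one, near-zero sets in the unit ball lie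
close to the zero set of some polynomial with coefficients of norm one. -/
lemma exists_uniform_abs_eval_le_imp_mem_cnbhd (k D : ℕ) {β : ℝ} (hβ : 0 < β) :
    ∃ ε > (0 : ℝ), ∀ c : lowExponents k D → ℝ, ‖c‖ = 1 →
      ∃ c' : lowExponents k D → ℝ, ‖c'‖ = 1 ∧ ∀ x ∈ closedBall (0 : Fin k → ℝ) 1,
        |MvPolynomial.eval x (polyOfCoeffs c)| < ε →
          x ∈ cnbhd {y : Fin k → ℝ | MvPolynomial.eval y (polyOfCoeffs c') = 0} β := by
  have hcomp : IsCompact (sphere (0 : lowExponents k D → ℝ) 1) := isCompact_sphere _ _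
  suffices h : ∃ ε > (0 : ℝ), ∀ c ∈ sphere (0 : lowExponents k D → ℝ) 1,
      ∃ c' : lowExponents k D → ℝ, ‖c'‖ = 1 ∧ ∀ x ∈ closedBall (0 : Fin k → ℝ) 1,
        |MvPolynomial.eval x (polyOfCoeffs c)| < ε →
          x ∈ cnbhd {y : Fin k → ℝ | MvPolynomial.eval y (polyOfCoeffs c') = 0} β by
    simpa using h
  refine hcomp.induction_on ⟨1, one_pos, by simp⟩ ?_ ?_ ?_
  · rintro S T hST ⟨ε, hε, h⟩
    exact ⟨ε, hε, fun c hc => h c (hST hc)⟩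
  · rintro S T ⟨ε, hε, h⟩ ⟨ε', hε', h'⟩
    refine ⟨min ε ε', lt_min hε hε', fun c hc => ?_⟩
    rcases hc with hc | hc
    · obtain ⟨c', hc', H⟩ := h c hc
      exact ⟨c', hc', fun x hx hlt => H x hx (hlt.trans_le (min_le_left _ _))⟩
    · obtain ⟨c', hc', H⟩ := h' c hc
      exact ⟨c', hc', fun x hx hlt => H x hx (hlt.trans_le (min_le_right _ _))⟩
  · intro c hc
    obtain ⟨ε, hε, h⟩ := exists_pos_abs_le_imp_mem_cnbhd
      (MvPolynomial.continuous_eval (polyOfCoeffs c)) hβ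
    set N : ℝ := (lowExponents k D).card + 1 with hN
    have hN0 : 0 < N := by positivity
    refine ⟨ball c (ε / 2 / N), mem_nhdsWithin_of_mem_nhds (ball_mem_nhds _ (by positivity)),
      ε / 2, by positivity, fun b hb => ⟨c, by simpa using hc, fun x hx hlt => h x hx ?_⟩⟩
    have h₁ := abs_eval_polyOfCoeffs_le (c - b) hx
    have h₂ : ‖c - b‖ < ε / 2 / N := by simpa [dist_eq_norm'] using hb
    rw [eval_polyOfCoeffs_sub] at h₁
    rw [lt_div_iff₀ hN0] at h₂
    have h₃ := abs_sub_abs_le_abs_sub (MvPolynomial.eval x (polyOfCoeffs c))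
      (MvPolynomial.eval x (polyOfCoeffs b))
    nlinarith [norm_nonneg (c - b)]

end Coefficients

section Approximation

variable {k D : ℕ} {s : Set (Fin k → ℝ)} {f : (Fin k → ℝ) → ℝ}

/-- The coefficients of the degree `D` Taylor polynomial at `0` of a function on `s`. -/
def taylorCoeffs {k : ℕ} (D : ℕ) (s : Set (Fin k → ℝ)) (f : (Fin k → ℝ) → ℝ) :
    lowExponents k D → ℝ :=
  fun m => mderivW s m.1 f 0 / ((∏ j, (m.1 j).factorial : ℕ) : ℝ)

lemma prod_factorial_pos (m : Fin k → ℕ) : (0 : ℝ) < ((∏ j, (m j).factorial : ℕ) : ℝ) := by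
  exact_mod_cast Finset.prod_pos fun j _ => Nat.factorial_pos _

lemma abs_mderivW_zero_le (m : lowExponents k D) :
    |mderivW s m.1 f 0| ≤ D.factorial * ‖taylorCoeffs D s f‖ := by
  have h := norm_le_pi_norm (taylorCoeffs D s f) m
  have hpos := prod_factorial_pos m.1
  rw [taylorCoeffs, norm_div, Real.norm_eq_abs, Real.norm_of_nonneg hpos.le,
    div_le_iff₀ hpos] at h
  refine h.trans ?_
  rw [mul_comm]
  refine mul_le_mul_of_nonneg_right ?_ (norm_nonneg _)
  exact_mod_cast (Nat.le_of_dvd (Nat.factorial_pos _)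
    (Nat.prod_factorial_dvd_factorial_sum _ _)).trans
    (Nat.factorial_le (mem_lowExponents.1 m.2))

/-- Taylor's theorem with a uniform remainder bound. -/
lemma abs_sub_eval_taylorCoeffs_le {η : ℝ} (hη : 0 ≤ η) (hs : UniqueDiffOn ℝ s)
    (hs' : s ⊆ closure (interior s)) (hconv : Convex ℝ s) (h0 : (0 : Fin k → ℝ) ∈ s)
    (hs1 : s ⊆ closedBall 0 1) (hf : ContDiffOn ℝ (D + 1 : ℕ) f s)
    (hd : ∀ α : Fin k → ℕ, ∑ j, α j = D + 1 → ∀ x ∈ s, |mderivW s α f x| ≤ η) :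
    ∀ x ∈ s, |f x - MvPolynomial.eval x (polyOfCoeffs (taylorCoeffs D s f))| ≤
      η * (1 + k) ^ (D + 1) := by
  set p := polyOfCoeffs (taylorCoeffs D s f) with hp
  have hpc : ContDiffOn ℝ (D + 1 : ℕ) (fun y => MvPolynomial.eval y p) s :=
    (contDiff_eval_mvPolynomial p _).contDiffOn
  have hsub : ∀ w : List (Fin k), w.length ≤ D + 1 → ∀ x ∈ s,
      wordDerivW s w (f - fun y => MvPolynomial.eval y p) x =
        mderivW s (wordExponent w) f x - MvPolynomial.eval x (wordPDeriv w p) := by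
    intro w hw x hx
    rw [wordDerivW_sub hs hf hpc w hw hx, Pi.sub_apply, wordDerivW_eval hs p w hx,
      wordDerivW_eq_mderivW hs hs' hf hw hx]
  refine abs_wordDerivW_le (f := f - fun y => MvPolynomial.eval y p) hη hs hconv h0 hs1
    (hf.sub hpc) (fun w hw => ?_)
    (fun w hw x hx => ?_) [] (by simp)
  · have hmem : wordExponent w ∈ lowExponents k D :=
      mem_lowExponents.2 (by rwa [sum_wordExponent])
    rw [hsub w (by omega) 0 h0, eval_zero_wordPDeriv, hp, coeff_polyOfCoeffs _ ⟨_, hmem⟩,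
      taylorCoeffs, mul_div_cancel₀ _ (prod_factorial_pos _).ne', sub_self, abs_zero]
    exact hη
  · rw [hsub w hw.le x hx, wordPDeriv_eq_zero (by
      rw [hw]; exact (totalDegree_polyOfCoeffs_le _).trans_lt (Nat.lt_succ_self _)),
      map_zero, sub_zero]
    exact hd _ (by rw [sum_wordExponent, hw]) x hx

/-- All partial derivatives of order at most `D` are controlled by the Taylor coefficients at `0`
and the derivatives of order `D + 1`. -/
lemma abs_mderivW_le {η : ℝ} (hη : 0 ≤ η) (hs : UniqueDiffOn ℝ s)
    (hs' : s ⊆ closure (interior s)) (hconv : Convex ℝ s) (h0 : (0 : Fin k → ℝ) ∈ s)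
    (hs1 : s ⊆ closedBall 0 1) (hf : ContDiffOn ℝ (D + 1 : ℕ) f s)
    (hd : ∀ α : Fin k → ℕ, ∑ j, α j = D + 1 → ∀ x ∈ s, |mderivW s α f x| ≤ η)
    {α : Fin k → ℕ} (hα : ∑ j, α j ≤ D) :
    ∀ x ∈ s, |mderivW s α f x| ≤
      (D.factorial * ‖taylorCoeffs D s f‖ + η) * (1 + k) ^ (D + 1) := by
  obtain ⟨w, rfl⟩ := exists_wordExponent_eq α
  rw [sum_wordExponent] at hα
  intro x hx
  rw [← wordDerivW_eq_mderivW hs hs' hf (hα.trans (Nat.le_succ D)) hx]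
  refine abs_wordDerivW_le (by positivity) hs hconv h0 hs1 hf (fun v hv => ?_)
    (fun v hv y hy => ?_) w (hα.trans (Nat.le_succ D)) x hx
  · rw [wordDerivW_eq_mderivW hs hs' hf (by omega) h0]
    have := abs_mderivW_zero_le (s := s) (f := f)
      ⟨wordExponent v, mem_lowExponents.2 (by rwa [sum_wordExponent] : _ ≤ D)⟩
    linarith
  · rw [wordDerivW_eq_mderivW hs hs' hf hv.le hy]
    have := hd (wordExponent v) (by rw [sum_wordExponent, hv]) y hy
    have : 0 ≤ D.factorial * ‖taylorCoeffs D s f‖ := by positivity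
    linarith

end Approximation

/-- **Lemma (functions close to polynomials of degree `D` on the unit ball have
levelsets close to polynomial zero sets):** there is `δ > 0` such that every
not-identically-zero `C^{D+1}` function `f` on `B = B(0,1)` whose `(D+1)`-st order
derivatives are bounded by `δ·‖f‖_{C^D,B}` admits `g ∈ P_D` with
`Z_f ⊆ f⁻¹((−δ‖f‖_{C^D,B}, δ‖f‖_{C^D,B})) ⊆ Z_g^{(β)}`; in particular
`Z_f^{(β)} ⊆ Z_g^{(2β)}`. -/
theorem approximate_levelset_unit_ball (k D : ℕ) (hk : 1 ≤ k) (hD : 1 ≤ D)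
    (β : ℝ) (hβ : 0 < β) :
    ∃ δ > (0 : ℝ), ∀ f : (Fin k → ℝ) → ℝ,
      ContDiffOn ℝ ((D : ℕ∞) + 1) f (closedBall 0 1) →
      (∃ x ∈ closedBall (0 : Fin k → ℝ) 1, f x ≠ 0) →
      (∀ α : Fin k → ℕ, (∑ j, α j) = D + 1 → ∀ x ∈ closedBall (0 : Fin k → ℝ) 1,
        |mderivW (closedBall 0 1) α f x| ≤ δ * CDnorm D (closedBall 0 1) f) →
      ∃ g : MvPolynomial (Fin k) ℝ, IsPD k D g ∧
        {x ∈ closedBall (0 : Fin k → ℝ) 1 | f x = 0} ⊆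
          {x ∈ closedBall (0 : Fin k → ℝ) 1 |
            |f x| < δ * CDnorm D (closedBall 0 1) f} ∧
        {x ∈ closedBall (0 : Fin k → ℝ) 1 |
            |f x| < δ * CDnorm D (closedBall 0 1) f} ⊆
          cnbhd {x : Fin k → ℝ | MvPolynomial.eval x g = 0} β ∧
        cnbhd {x ∈ closedBall (0 : Fin k → ℝ) 1 | f x = 0} β ⊆
          cnbhd {x : Fin k → ℝ | MvPolynomial.eval x g = 0} (2 * β) := by
  obtain ⟨ε, hε, hunif⟩ := exists_uniform_abs_eval_le_imp_mem_cnbhd k D hβ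
  set K : ℝ := (1 + k) ^ (D + 1) with hK
  have hKpos : 0 < K := by positivity
  set δ : ℝ := min (1 / (2 * K)) (ε / (2 * D.factorial * K * (1 + K))) with hδ
  have hδpos : 0 < δ := by positivity
  have hδ₁ : δ * (2 * K) ≤ 1 := (le_div_iff₀ (by positivity)).1 (min_le_left _ _)
  have hδ₂ : δ * (2 * D.factorial * K * (1 + K)) ≤ ε :=
    (le_div_iff₀ (by positivity)).1 (min_le_right _ _)
  refine ⟨δ, hδpos, ?_⟩
  rintro f hf ⟨z, hz, hfz⟩ hd
  set B : Set (Fin k → ℝ) := closedBall 0 1 with hB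
  set N : ℝ := CDnorm D B f with hN
  have hconv : Convex ℝ B := convex_closedBall _ _
  have hint : (interior B).Nonempty :=
    ⟨0, ball_subset_interior_closedBall (mem_ball_self one_pos)⟩
  have hs : UniqueDiffOn ℝ B := uniqueDiffOn_convex hconv hint
  have hs' : B ⊆ closure (interior B) := by
    rw [hconv.closure_interior_eq_closure_of_nonempty_interior hint]
    exact subset_closure
  have h0 : (0 : Fin k → ℝ) ∈ B := mem_closedBall_self zero_le_one
  have hf' : ContDiffOn ℝ (D + 1 : ℕ) f B := by exact_mod_cast hf
  have hN0 : 0 ≤ N := Real.sSup_nonneg (by rintro _ ⟨α, _, x, _, rfl⟩; exact abs_nonneg _)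
  set c := taylorCoeffs D B f with hc
  have hbound : ∀ y ∈ {y : ℝ | ∃ α : Fin k → ℕ, (∑ j, α j) ≤ D ∧ ∃ x ∈ B, y = |mderivW B α f x|},
      y ≤ (D.factorial * ‖c‖ + δ * N) * K := by
    rintro _ ⟨α, hα, x, hx, rfl⟩
    exact abs_mderivW_le (by positivity) hs hs' hconv h0 Subset.rfl hf' hd hα x hx
  have hmem : |f z| ∈
      {y : ℝ | ∃ α : Fin k → ℕ, (∑ j, α j) ≤ D ∧ ∃ x ∈ B, y = |mderivW B α f x|} := by
    exact ⟨0, by simp, z, hz, by rw [mderivW_zero]⟩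
  have hNpos : 0 < N := (abs_pos.2 hfz).trans_le (le_csSup ⟨_, hbound⟩ hmem)
  have hNle : N ≤ (D.factorial * ‖c‖ + δ * N) * K := csSup_le ⟨_, hmem⟩ hbound
  have hNc : N ≤ 2 * D.factorial * K * ‖c‖ := by nlinarith
  have hcpos : 0 < ‖c‖ := by
    by_contra h
    have : ‖c‖ = 0 := le_antisymm (not_lt.1 h) (norm_nonneg _)
    rw [this, mul_zero] at hNc
    exact hNc.not_gt hNpos
  obtain ⟨c', hc', H⟩ := hunif (‖c‖⁻¹ • c) (by
    rw [norm_smul, norm_inv, norm_norm, inv_mul_cancel₀ hcpos.ne'])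
  have hsub₁ : {x ∈ B | f x = 0} ⊆ {x ∈ B | |f x| < δ * N} := by
    rintro x ⟨hx, hfx⟩
    refine ⟨hx, ?_⟩
    rw [hfx, abs_zero]
    positivity
  have hsub₂ : {x ∈ B | |f x| < δ * N} ⊆
      cnbhd {x : Fin k → ℝ | MvPolynomial.eval x (polyOfCoeffs c') = 0} β := by
    rintro x ⟨hx, hfx⟩
    refine H x hx ?_
    have hT := abs_sub_eval_taylorCoeffs_le (by positivity) hs hs' hconv h0 Subset.rfl hf' hd x hx
    rw [← hc, ← hK] at hT
    rw [eval_polyOfCoeffs_smul, abs_mul, abs_inv, abs_norm, inv_mul_lt_iff₀ hcpos]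
    have h₁ := abs_sub_abs_le_abs_sub (MvPolynomial.eval x (polyOfCoeffs c)) (f x)
    rw [abs_sub_comm] at h₁
    calc |MvPolynomial.eval x (polyOfCoeffs c)| < δ * (1 + K) * N := by linarith
      _ ≤ δ * (1 + K) * (2 * D.factorial * K * ‖c‖) := by gcongr
      _ = ‖c‖ * (δ * (2 * D.factorial * K * (1 + K))) := by ring
      _ ≤ ‖c‖ * ε := by gcongr
  refine ⟨polyOfCoeffs c', isPD_polyOfCoeffs hc', hsub₁, hsub₂, ?_⟩
  rintro x ⟨y, hy, hxy⟩
  obtain ⟨u, hu, hyu⟩ := hsub₂ (hsub₁ hy)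
  exact ⟨u, hu, (dist_triangle x y u).trans (by linarith)⟩
end
end
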